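/- Let G be a graph of order n ≥ 6 with spectral radius ρ(G) ≥ √(2n−4). Then G contains a chorded cycle, unless G is isomorphic to the complete bipartite graph K_{2,n−2}. -/

import Mathlib

/-- The spectral radius (largest adjacency eigenvalue) of a finite simple graph. -/
noncomputable def specRad {V : Type*} [Finite V] (G : SimpleGraph V) : ℝ :=
  letI := Fintype.ofFinite V
  letI := Classical.decEq V
  letI := Classical.decRel G.Adj
  sSup (spectrum ℝ (G.adjMatrix ℝ))

/-- A graph has a chorded cycle if it contains a cycle `c` together with an edge of the
graph joining two vertices of `c` that is not an edge of `c` (i.e. a chord, joining two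
non-consecutive vertices of the cycle). -/
def HasChordedCycle {V : Type*} (G : SimpleGraph V) : Prop :=
  ∃ (u : V) (c : G.Walk u u), c.IsCycle ∧
    ∃ x y, x ∈ c.support ∧ y ∈ c.support ∧ G.Adj x y ∧ s(x, y) ∉ c.edges

section ChordedCycle

open Finset

variable {V : Type*} {G H : SimpleGraph V}

lemma HasChordedCycle.mono (h : H ≤ G) : HasChordedCycle H → HasChordedCycle G := by
  rintro ⟨u, c, hc, x, y, hx, hy, hxy, he⟩
  exact ⟨u, c.mapLe h, (SimpleGraph.Walk.isCycle_mapLe h).2 hc, x, y,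
    by simpa using hx, by simpa using hy, h hxy, by simpa using he⟩

/-- A path together with two edges from its start `a` to later vertices `b`, `c`, both different
from the second vertex, yields a chorded cycle. -/
lemma hasChordedCycle_of_isPath {a d b c : V} {p : G.Walk a d} (hp : p.IsPath)
    (hb : b ∈ p.support) (hc : c ∈ p.support) (hab : G.Adj a b) (hac : G.Adj a c) (hbc : b ≠ c)
    (hbs : b ≠ p.snd) (hcs : c ≠ p.snd) : HasChordedCycle G := by
  classical
  have key : ∀ {b c : V} (_ : b ∈ p.support) (hc : c ∈ p.support), G.Adj a b → G.Adj a c →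
      b ≠ c → b ≠ p.snd → c ≠ p.snd →
      b ∈ (p.takeUntil c hc).support → HasChordedCycle G := by
    intro b c _ hc hab hac hbc hbs hcs hmem
    refine ⟨c, .cons hac.symm (p.takeUntil c hc), ?_, a, b, by simp, by simp [hmem], hab, ?_⟩
    · rw [SimpleGraph.Walk.cons_isCycle_iff]
      refine ⟨hp.takeUntil hc, fun he => hcs (hp.eq_snd_of_mem_edges ?_)⟩
      exact p.edges_takeUntil_subset_edges hc (Sym2.eq_swap ▸ he)
    · rw [SimpleGraph.Walk.edges_cons, List.mem_cons, not_or]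
      refine ⟨fun h => ?_, fun he => hbs (hp.eq_snd_of_mem_edges ?_)⟩
      · rcases Sym2.eq_iff.1 h with ⟨h, -⟩ | ⟨-, h⟩
        · exact hac.ne h
        · exact hbc h
      · exact p.edges_takeUntil_subset_edges hc he
  rcases List.prefix_or_prefix_of_prefix (p.support_takeUntil_prefix_support hb)
    (p.support_takeUntil_prefix_support hc) with h | h
  · exact key hb hc hab hac hbc hbs hcs (h.subset (SimpleGraph.Walk.end_mem_support _))
  · exact key hc hb hac hab hbc.symm hcs hbs (h.subset (SimpleGraph.Walk.end_mem_support _))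

/-- If every vertex of a nonempty set has at least three neighbours in the set, there is a
chorded cycle. -/
lemma hasChordedCycle_of_three_le [Fintype V] [DecidableRel G.Adj] (S : Finset V)
    (hS : S.Nonempty) (h : ∀ v ∈ S, 3 ≤ #{w ∈ S | G.Adj v w}) : HasChordedCycle G := by
  classical
  let P : ℕ → Prop := fun k => ∃ (a d : V) (p : G.Walk a d),
    p.IsPath ∧ (∀ z ∈ p.support, z ∈ S) ∧ p.length = k
  have hP0 : P 0 := by
    obtain ⟨s, hs⟩ := hS
    exact ⟨s, s, .nil, by simp, by simpa using hs, rfl⟩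
  have hbound : ∀ k, P k → k ≤ Fintype.card V := by
    rintro k ⟨a, d, p, hp, -, rfl⟩
    exact hp.length_lt.le
  obtain ⟨a, d, p, hp, hpS, hlen⟩ : P (Nat.findGreatest P (Fintype.card V)) :=
    Nat.findGreatest_spec (Nat.zero_le _) hP0
  have hmax : ∀ k, P k → k ≤ p.length := fun k hk =>
    hlen ▸ Nat.le_findGreatest (hbound k hk) hk
  have hnb : ∀ w ∈ S, G.Adj a w → w ∈ p.support := by
    intro w hw haw
    by_contra hwp
    have := hmax (p.length + 1) ⟨w, d, .cons haw.symm p, hp.cons hwp, by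
      simp only [SimpleGraph.Walk.support_cons, List.mem_cons]
      rintro z (rfl | hz)
      exacts [hw, hpS z hz], rfl⟩
    omega
  have h3 := h a (hpS a p.start_mem_support)
  have h2 : 1 < #(({w ∈ S | G.Adj a w} : Finset V).erase p.snd) := by
    have := Finset.pred_card_le_card_erase (s := ({w ∈ S | G.Adj a w} : Finset V)) (a := p.snd)
    omega
  obtain ⟨b, hb, c, hc, hbc⟩ := Finset.one_lt_card.1 h2
  simp only [mem_erase, mem_filter] at hb hc
  exact hasChordedCycle_of_isPath hp (hnb b hb.2.1 hb.2.2) (hnb c hc.2.1 hc.2.2) hb.2.2 hc.2.2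
    hbc hb.1 hc.1

/-- A four-cycle `a b c d` with the diagonal `a c`. -/
lemma hasChordedCycle_of_four {a b c d : V} (hab : G.Adj a b) (hbc : G.Adj b c) (hcd : G.Adj c d)
    (hda : G.Adj d a) (hac : G.Adj a c) (hbd : b ≠ d) : HasChordedCycle G := by
  have hp : (SimpleGraph.Walk.cons hab (.cons hbc (.cons hcd .nil))).IsPath := by
    simp [hab.ne, hbc.ne, hcd.ne, hda.ne', hac.ne, hbd]
  exact hasChordedCycle_of_isPath hp (b := c) (c := d) (by simp) (by simp) hac hda.symm hcd.ne
    (by simpa using hbc.ne') (by simpa using hbd.symm)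

/-- A five-cycle `a b c d e` with the diagonal `a c`. -/
lemma hasChordedCycle_of_five {a b c d e : V} (hab : G.Adj a b) (hbc : G.Adj b c)
    (hcd : G.Adj c d) (hde : G.Adj d e) (hea : G.Adj e a) (hac : G.Adj a c) (had : a ≠ d)
    (hbd : b ≠ d) (hbe : b ≠ e) (hce : c ≠ e) : HasChordedCycle G := by
  have hp : (SimpleGraph.Walk.cons hab (.cons hbc (.cons hcd (.cons hde .nil)))).IsPath := by
    simp [hab.ne, hbc.ne, hcd.ne, hde.ne, hea.ne', hac.ne, had, hbd, hbe, hce]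
  exact hasChordedCycle_of_isPath hp (b := c) (c := e) (by simp) (by simp) hac hea.symm hce
    (by simpa using hbc.ne') (by simpa using hbe.symm)

end ChordedCycle

section EdgeCount

open Finset

variable {V : Type*} (G : SimpleGraph V)

open Classical in
/-- The real-valued indicator of adjacency. -/
noncomputable def adjInd (v w : V) : ℝ := if G.Adj v w then 1 else 0

variable {G}

lemma adjInd_of_adj {v w : V} (h : G.Adj v w) : adjInd G v w = 1 := if_pos h

lemma adjInd_of_not_adj {v w : V} (h : ¬ G.Adj v w) : adjInd G v w = 0 := if_neg h

lemma adjInd_nonneg (v w : V) : 0 ≤ adjInd G v w := by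
  unfold adjInd; split_ifs <;> norm_num

lemma adjInd_le_one (v w : V) : adjInd G v w ≤ 1 := by
  unfold adjInd; split_ifs <;> norm_num

lemma adjInd_comm (v w : V) : adjInd G v w = adjInd G w v := by
  by_cases h : G.Adj v w
  · rw [adjInd_of_adj h, adjInd_of_adj h.symm]
  · rw [adjInd_of_not_adj h, adjInd_of_not_adj fun h' => h h'.symm]

lemma adjInd_self (v : V) : adjInd G v v = 0 := adjInd_of_not_adj (G.loopless.irrefl v)

lemma sum_adjInd_le_one {z : V} {S : Finset V}
    (h : ∀ v ∈ S, ∀ w ∈ S, G.Adj z v → G.Adj z w → v = w) : ∑ v ∈ S, adjInd G z v ≤ 1 := by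
  classical
  unfold adjInd
  rw [Finset.sum_boole]
  have : #{v ∈ S | G.Adj z v} ≤ 1 := by
    refine Finset.card_le_one.2 fun v hv w hw => ?_
    rw [mem_filter] at hv hw
    exact h v hv.1 w hw.1 hv.2 hw.2
  exact_mod_cast this

/-- A triangle-free graph without chorded cycles spans at most `2|S| - 4` edges on a set `S` of at
least three vertices. -/
lemma sum_sum_adjInd_le [Fintype V] (hG : ¬ HasChordedCycle G)
    (htri : ∀ a b c, G.Adj a b → G.Adj b c → ¬ G.Adj a c) (S : Finset V) (hS : 3 ≤ #S) :
    ∑ v ∈ S, ∑ w ∈ S, adjInd G v w ≤ 4 * #S - 8 := by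
  classical
  obtain ⟨k, hk⟩ : ∃ k, #S = k := ⟨_, rfl⟩
  rw [hk] at hS ⊢
  induction k, hS using Nat.le_induction generalizing S with
  | base =>
    obtain ⟨a, b, c, hab, hac, hbc, rfl⟩ := Finset.card_eq_three.1 hk
    rw [Finset.sum_insert (by simp [hab, hac]), Finset.sum_pair hbc]
    simp only [Finset.sum_insert (show a ∉ ({b, c} : Finset V) by simp [hab, hac]),
      Finset.sum_pair hbc, adjInd_self, adjInd_comm b a, adjInd_comm c a, adjInd_comm c b]
    have h := htri a b c
    unfold adjInd
    split_ifs <;> first | (norm_num; done) | tauto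
  | succ k hk3 ih =>
    obtain ⟨v, hv, hdeg⟩ : ∃ v ∈ S, #{w ∈ S | G.Adj v w} ≤ 2 := by
      by_contra! hcon
      exact hG (hasChordedCycle_of_three_le S (Finset.card_pos.1 (by omega)) hcon)
    have hT := ih (S.erase v) (by rw [Finset.card_erase_of_mem hv]; omega)
    have hd : ∑ w ∈ S, adjInd G v w ≤ 2 := by
      unfold adjInd
      rw [Finset.sum_boole]
      exact_mod_cast hdeg
    rw [← Finset.add_sum_erase S _ hv] at hd ⊢
    rw [adjInd_self] at hd
    rw [← Finset.add_sum_erase S _ hv, adjInd_self]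
    have hsplit : ∑ x ∈ S.erase v, ∑ w ∈ S, adjInd G x w =
        ∑ x ∈ S.erase v, adjInd G v x + ∑ x ∈ S.erase v, ∑ w ∈ S.erase v, adjInd G x w := by
      rw [← Finset.sum_add_distrib]
      refine Finset.sum_congr rfl fun x _ => ?_
      rw [← Finset.add_sum_erase S _ hv, adjInd_comm]
    rw [hsplit]
    push_cast
    linarith

/-- In a graph without chorded cycles there are at most `2(|A| + |B|) - 4` edges between disjoint
sets `A` and `B` with at least three vertices in total. -/
lemma sum_sum_adjInd_le_of_disjoint [Fintype V] (hG : ¬ HasChordedCycle G) (A B : Finset V)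
    (hAB : Disjoint A B) (hcard : 3 ≤ #A + #B) :
    ∑ v ∈ A, ∑ w ∈ B, adjInd G v w ≤ 2 * (#A + #B) - 4 := by
  classical
  have hne : ∀ {x}, x ∈ A → x ∉ B := fun hx => Finset.disjoint_left.1 hAB hx
  let H : SimpleGraph V :=
    { Adj := fun v w => G.Adj v w ∧ (v ∈ A ∧ w ∈ B ∨ v ∈ B ∧ w ∈ A)
      symm := ⟨fun v w h => ⟨h.1.symm, by tauto⟩⟩
      loopless := ⟨fun v h => G.loopless.irrefl v h.1⟩ }
  have hH := sum_sum_adjInd_le (G := H) (fun h => hG (h.mono fun v w (h : H.Adj v w) => h.1))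
    (by
      rintro a b c ⟨-, h1⟩ ⟨-, h2⟩ ⟨-, h3⟩
      have ha := @hne a
      have hb := @hne b
      have hc := @hne c
      tauto) (A ∪ B) (by rwa [Finset.card_union_of_disjoint hAB])
  rw [Finset.card_union_of_disjoint hAB, Finset.sum_union hAB] at hH
  simp only [Finset.sum_union hAB] at hH
  have hab : ∀ v ∈ A, ∀ w ∈ B, adjInd H v w = adjInd G v w := by
    intro v hv w hw
    have : H.Adj v w ↔ G.Adj v w := ⟨fun h => h.1, fun h => ⟨h, .inl ⟨hv, hw⟩⟩⟩
    simp only [adjInd, this]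
  have h1 : ∑ v ∈ A, ∑ w ∈ B, adjInd H v w = ∑ v ∈ A, ∑ w ∈ B, adjInd G v w :=
    Finset.sum_congr rfl fun v hv => Finset.sum_congr rfl fun w hw => hab v hv w hw
  have h2 : ∑ v ∈ B, ∑ w ∈ A, adjInd H v w = ∑ v ∈ A, ∑ w ∈ B, adjInd G v w := by
    rw [Finset.sum_comm, ← h1]
    exact Finset.sum_congr rfl fun v _ => Finset.sum_congr rfl fun w _ => adjInd_comm _ _
  have h3 : 0 ≤ ∑ v ∈ A, ∑ w ∈ A, adjInd H v w :=
    Finset.sum_nonneg fun v _ => Finset.sum_nonneg fun w _ => adjInd_nonneg _ _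
  have h4 : 0 ≤ ∑ v ∈ B, ∑ w ∈ B, adjInd H v w :=
    Finset.sum_nonneg fun v _ => Finset.sum_nonneg fun w _ => adjInd_nonneg _ _
  simp only [Finset.sum_add_distrib] at hH
  push_cast at hH
  linarith

end EdgeCount

section Spectral

open Finset

variable {V : Type*} [Fintype V] {G : SimpleGraph V}

/-- A graph of positive spectral radius `ρ` has a nonnegative vector `x` with maximal entry `1`
that satisfies `ρ x ≤ A x` entrywise. -/
lemma exists_le_sum_adjInd_mul (h : 0 < specRad G) :
    ∃ x : V → ℝ, (∀ v, 0 ≤ x v) ∧ (∀ v, x v ≤ 1) ∧ (∃ u, x u = 1) ∧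
      ∀ v, specRad G * x v ≤ ∑ w, adjInd G v w * x w := by
  classical
  obtain ⟨y, hy0, hy⟩ : ∃ y : V → ℝ, y ≠ 0 ∧
      ∀ v, specRad G * y v = ∑ w, adjInd G v w * y w := by
    have hmem : specRad G ∈ spectrum ℝ (G.adjMatrix ℝ) := by
      have hrw : specRad G = sSup (spectrum ℝ (G.adjMatrix ℝ)) := by
        unfold specRad
        congr!
      rw [hrw] at h ⊢
      refine Set.Nonempty.csSup_mem ?_ Matrix.finite_real_spectrum
      by_contra hne
      rw [Set.not_nonempty_iff_eq_empty.1 hne, Real.sSup_empty] at h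
      exact h.false
    rw [spectrum.mem_iff, Matrix.isUnit_iff_isUnit_det, isUnit_iff_ne_zero, not_not,
      ← Matrix.exists_mulVec_eq_zero_iff] at hmem
    obtain ⟨y, hy0, hy⟩ := hmem
    refine ⟨y, hy0, fun v => ?_⟩
    rw [Matrix.sub_mulVec, sub_eq_zero, Algebra.algebraMap_eq_smul_one, Matrix.smul_mulVec,
      Matrix.one_mulVec] at hy
    have := congrFun hy v
    simpa [Matrix.mulVec, dotProduct, SimpleGraph.adjMatrix_apply, adjInd] using this
  obtain ⟨v₀, hv₀⟩ := Function.ne_iff.1 hy0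
  obtain ⟨u, -, hu⟩ := Finset.exists_max_image univ (fun v => |y v|) ⟨v₀, mem_univ _⟩
  have hpos : 0 < |y u| := (abs_pos.2 hv₀).trans_le (hu v₀ (mem_univ _))
  refine ⟨fun v => |y v| / |y u|, fun v => by positivity,
    fun v => (div_le_one hpos).2 (hu v (mem_univ _)), ⟨u, div_self hpos.ne'⟩, fun v => ?_⟩
  simp only [← mul_div_assoc, ← Finset.sum_div]
  gcongr
  calc specRad G * |y v| = |∑ w, adjInd G v w * y w| := by
        rw [← hy v, abs_mul, abs_of_pos h]
    _ ≤ ∑ w, |adjInd G v w * y w| := Finset.abs_sum_le_sum_abs _ _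
    _ = ∑ w, adjInd G v w * |y w| :=
        Finset.sum_congr rfl fun w _ => by rw [abs_mul, abs_of_nonneg (adjInd_nonneg v w)]

open Classical in
lemma sq_le_sum_sum {ρ : ℝ} (hρ : 0 ≤ ρ) {x : V → ℝ}
    (hx : ∀ v, ρ * x v ≤ ∑ w, adjInd G v w * x w) {u : V} (hu : x u = 1) :
    ρ ^ 2 ≤ ∑ v with G.Adj u v, ∑ w, adjInd G v w * x w := by
  have h1 : ρ ≤ ∑ v with G.Adj u v, x v := by
    have := hx u
    rw [hu, mul_one] at this
    refine this.trans_eq ?_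
    rw [Finset.sum_filter]
    exact Finset.sum_congr rfl fun v _ => by unfold adjInd; split_ifs <;> simp
  calc ρ ^ 2 ≤ ρ * ∑ v with G.Adj u v, x v := by rw [sq]; gcongr
    _ = ∑ v with G.Adj u v, ρ * x v := Finset.mul_sum _ _ _
    _ ≤ _ := Finset.sum_le_sum fun v _ => hx v

/-- A vertex at which the vector attains its maximum lies in no triangle. -/
lemma not_adj_of_adj_of_adj (hn : 6 ≤ Fintype.card V) (hG : ¬ HasChordedCycle G) {ρ : ℝ}
    (hρ0 : 0 ≤ ρ) (hρ : 2 * (Fintype.card V : ℝ) - 4 ≤ ρ ^ 2) {x : V → ℝ} (hx0 : ∀ v, 0 ≤ x v)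
    (hx1 : ∀ v, x v ≤ 1) (hx : ∀ v, ρ * x v ≤ ∑ w, adjInd G v w * x w) {u : V} (hu : x u = 1)
    {a b : V} (hua : G.Adj u a) (hub : G.Adj u b) : ¬ G.Adj a b := by
  classical
  intro hab
  let N : Finset V := {v | G.Adj u v}
  let M : Finset V := {v | ¬ G.Adj u v}
  let N₁ : Finset V := {v ∈ N | ∃ z ∈ N, G.Adj v z}
  let N₀ : Finset V := {v ∈ N | ¬ ∃ z ∈ N, G.Adj v z}
  let M₁ : Finset V := {w ∈ M | w ≠ u ∧ ∃ z ∈ N₁, G.Adj w z}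
  let M₀ : Finset V := {w ∈ M | ¬ (w ≠ u ∧ ∃ z ∈ N₁, G.Adj w z)}
  have memN : ∀ {v}, v ∈ N ↔ G.Adj u v := by simp [N]
  have memM : ∀ {v}, v ∈ M ↔ ¬ G.Adj u v := by simp [M]
  have memN₁ : ∀ {v}, v ∈ N₁ ↔ G.Adj u v ∧ ∃ z, G.Adj u z ∧ G.Adj v z := by simp [N₁, memN]
  have splitV : ∀ f : V → ℝ, ∑ w, f w = ∑ w ∈ N, f w + ∑ w ∈ M, f w := fun f =>
    (Finset.sum_filter_add_sum_filter_not univ _ f).symm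
  have splitN : ∀ f : V → ℝ, ∑ w ∈ N, f w = ∑ w ∈ N₁, f w + ∑ w ∈ N₀, f w := fun f =>
    (Finset.sum_filter_add_sum_filter_not N _ f).symm
  have splitM : ∀ f : V → ℝ, ∑ w ∈ M, f w = ∑ w ∈ M₁, f w + ∑ w ∈ M₀, f w := fun f =>
    (Finset.sum_filter_add_sum_filter_not M _ f).symm
  have hN : ∀ z ∈ N, ∑ v ∈ N, adjInd G z v ≤ 1 := by
    refine fun z hz => sum_adjInd_le_one fun v hv w hw hzv hzw => ?_
    by_contra hvw
    exact hG (hasChordedCycle_of_four (memN.1 hv) hzv.symm hzw (memN.1 hw).symm (memN.1 hz) hvw)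
  have hM₁ : ∀ z ∈ M₁, ∑ v ∈ N, adjInd G z v ≤ 1 := by
    intro w hw
    obtain ⟨-, hwu, c, hc, hwc⟩ := mem_filter.1 hw
    obtain ⟨huc, d, hud, hcd⟩ := memN₁.1 hc
    have key : ∀ v ∈ N, G.Adj w v → v = c := by
      intro v hv hwv
      rw [memN] at hv
      by_contra hvc
      by_cases hvd : v = d
      · subst hvd
        exact hG (hasChordedCycle_of_four huc.symm hv hwv.symm hwc hcd hwu.symm)
      · exact hG (hasChordedCycle_of_five hud hcd.symm hwc.symm hwv hv.symm huc hwu.symm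
          (fun h => memM.1 (mem_filter.1 hw).1 (h ▸ hud)) (Ne.symm hvd) (Ne.symm hvc))
    exact sum_adjInd_le_one fun v hv v' hv' h h' => (key v hv h).trans (key v' hv' h').symm
  have hNN : ∑ v ∈ N, ∑ z ∈ N, adjInd G v z * x z ≤ ∑ z ∈ N₁, x z := by
    rw [Finset.sum_comm, splitN]
    have h0 : ∑ z ∈ N₀, ∑ v ∈ N, adjInd G v z * x z = 0 := by
      refine Finset.sum_eq_zero fun z hz => Finset.sum_eq_zero fun v hv => ?_
      rw [adjInd_of_not_adj, zero_mul]
      exact fun h => (mem_filter.1 hz).2 ⟨v, hv, h.symm⟩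
    rw [h0, add_zero]
    refine Finset.sum_le_sum fun z hz => ?_
    rw [← Finset.sum_mul]
    refine mul_le_of_le_one_left (hx0 z) ?_
    simpa only [adjInd_comm] using hN z (mem_filter.1 hz).1
  have hle : ∀ S T : Finset V, ∑ v ∈ S, ∑ w ∈ T, adjInd G v w * x w ≤
      ∑ v ∈ S, ∑ w ∈ T, adjInd G v w := fun S T =>
    Finset.sum_le_sum fun v _ => Finset.sum_le_sum fun w _ =>
      mul_le_of_le_one_right (adjInd_nonneg v w) (hx1 w)
  have hc₁ : ∑ v ∈ N₁, ∑ w ∈ M, adjInd G v w ≤ #N₁ + #M₁ := by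
    rw [Finset.sum_comm]
    have : ∀ w ∈ M, ∑ v ∈ N₁, adjInd G v w ≤
        (if w = u then (#N₁ : ℝ) else 0) + (if w ∈ M₁ then 1 else 0) := by
      intro w hw
      by_cases hwu : w = u
      · have h1 : ∑ v ∈ N₁, adjInd G v w ≤ #N₁ := by
          simpa using Finset.sum_le_sum fun v (_ : v ∈ N₁) => adjInd_le_one (G := G) v w
        rw [if_pos hwu]
        split_ifs <;> linarith
      · rw [if_neg hwu, zero_add]
        split_ifs with hwM
        · refine le_trans ?_ (hM₁ w hwM)
          simp only [adjInd_comm _ w]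
          exact Finset.sum_le_sum_of_subset_of_nonneg (filter_subset _ _)
            fun _ _ _ => adjInd_nonneg _ _
        · refine (Finset.sum_eq_zero fun v hv => adjInd_of_not_adj fun h => hwM ?_).le
          exact mem_filter.2 ⟨hw, hwu, v, hv, h.symm⟩
    refine (Finset.sum_le_sum this).trans ?_
    rw [Finset.sum_add_distrib, Finset.sum_ite_eq', Finset.sum_ite_mem,
      Finset.inter_eq_right.2 (filter_subset _ _), if_pos (memM.2 (G.loopless.irrefl u)),
      Finset.sum_const, nsmul_one]
  have hc₀ : ∑ v ∈ N₀, ∑ w ∈ M, adjInd G v w = ∑ v ∈ N₀, ∑ w ∈ M₀, adjInd G v w := by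
    refine Finset.sum_congr rfl fun v hv => ?_
    rw [splitM, add_eq_right]
    refine Finset.sum_eq_zero fun w hw => adjInd_of_not_adj fun h => ?_
    obtain ⟨hvN, hv⟩ := mem_filter.1 hv
    obtain ⟨-, -, c, hc, hwc⟩ := mem_filter.1 hw
    have hcN := (mem_filter.1 hc).1
    have hvc : v ≠ c := fun h => hv (h ▸ (mem_filter.1 hc).2)
    have h2 : ∑ z ∈ ({v, c} : Finset V), adjInd G w z ≤ ∑ z ∈ N, adjInd G w z :=
      Finset.sum_le_sum_of_subset_of_nonneg (by simp [Finset.insert_subset_iff, hvN, hcN])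
        fun _ _ _ => adjInd_nonneg _ _
    rw [Finset.sum_pair hvc, adjInd_of_adj h.symm, adjInd_of_adj hwc] at h2
    linarith [hM₁ w hw]
  have hT : ρ * ∑ z ∈ N₁, x z ≤ ∑ z ∈ N₁, x z + (#N₁ + #M₁) := by
    calc ρ * ∑ z ∈ N₁, x z = ∑ z ∈ N₁, ρ * x z := Finset.mul_sum _ _ _
      _ ≤ ∑ z ∈ N₁, ∑ w, adjInd G z w * x w := Finset.sum_le_sum fun z _ => hx z
      _ = ∑ z ∈ N₁, ∑ w ∈ N, adjInd G z w * x w + ∑ z ∈ N₁, ∑ w ∈ M, adjInd G z w * x w := by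
          simp only [splitV, Finset.sum_add_distrib]
      _ ≤ _ := by
          refine add_le_add (le_trans ?_ hNN) ((hle N₁ M).trans hc₁)
          exact Finset.sum_le_sum_of_subset_of_nonneg (filter_subset _ _) fun v _ _ =>
            Finset.sum_nonneg fun w _ => mul_nonneg (adjInd_nonneg v w) (hx0 w)
  have hmain : ρ ^ 2 ≤ ∑ z ∈ N₁, x z + (#N₁ + #M₁) + ∑ v ∈ N₀, ∑ w ∈ M₀, adjInd G v w := by
    have h1 : ρ ^ 2 ≤ ∑ v ∈ N, ∑ w, adjInd G v w * x w := sq_le_sum_sum hρ0 hx hu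
    simp only [splitV, Finset.sum_add_distrib] at h1
    have h2 := hle N M
    rw [splitN fun v => ∑ w ∈ M, adjInd G v w, hc₀] at h2
    linarith
  have hcardN : #N₁ + #N₀ = #N := Finset.card_filter_add_card_filter_not _
  have hcardM : #M₁ + #M₀ = #M := Finset.card_filter_add_card_filter_not _
  have hcard : #N + #M = Fintype.card V := Finset.card_filter_add_card_filter_not _
  have hk : 1 ≤ #N₁ := Finset.card_pos.2 ⟨a, memN₁.2 ⟨hua, b, hub, hab⟩⟩
  have hm₀ : 1 ≤ #M₀ := Finset.card_pos.2 ⟨u, by simp [M₀, M]⟩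
  have hdisj : Disjoint N₀ M₀ := Finset.disjoint_left.2 fun v hv hv' =>
    memM.1 (mem_filter.1 hv').1 (memN.1 (mem_filter.1 hv).1)
  have hTn : 0 ≤ ∑ z ∈ N₁, x z := Finset.sum_nonneg fun z _ => hx0 z
  generalize ∑ z ∈ N₁, x z = T at hT hmain hTn
  have hcardR : (#N₁ : ℝ) + #M₁ + (#N₀ + #M₀) = Fintype.card V := by
    exact_mod_cast (by omega : #N₁ + #M₁ + (#N₀ + #M₀) = Fintype.card V)
  have hn' : (6 : ℝ) ≤ Fintype.card V := by exact_mod_cast hn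
  have hkR : (1 : ℝ) ≤ #N₁ := by exact_mod_cast hk
  have hρ2 : 2.8 < ρ := by
    by_contra! hcon
    nlinarith
  by_cases h3 : 3 ≤ #N₀ + #M₀
  · have := sum_sum_adjInd_le_of_disjoint hG N₀ M₀ hdisj h3
    have hkT : (#N₁ : ℝ) + #M₁ ≤ T := by linarith
    have : (0 : ℝ) ≤ #M₁ := Nat.cast_nonneg _
    nlinarith
  · have hsmall : ∑ v ∈ N₀, ∑ w ∈ M₀, adjInd G v w ≤ #N₀ + #M₀ - 1 := by
      have h1 : ∑ v ∈ N₀, ∑ w ∈ M₀, adjInd G v w ≤ (#N₀ : ℝ) * #M₀ := by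
        calc _ ≤ ∑ v ∈ N₀, ∑ w ∈ M₀, (1 : ℝ) :=
              Finset.sum_le_sum fun v _ => Finset.sum_le_sum fun w _ => adjInd_le_one v w
          _ = _ := by simp
      have h2 : #N₀ * #M₀ + 1 ≤ #N₀ + #M₀ := by
        have : #N₀ ≤ 1 := by omega
        interval_cases #N₀ <;> omega
      have h2R : (#N₀ : ℝ) * #M₀ + 1 ≤ #N₀ + #M₀ := by exact_mod_cast h2
      linarith
    have hm₀R : (1 : ℝ) ≤ #M₀ := by exact_mod_cast hm₀
    have hn₀R : (0 : ℝ) ≤ #N₀ := Nat.cast_nonneg _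
    have hT' : (ρ - 1) * T ≤ Fintype.card V - 1 := by linarith
    have hq : ρ ^ 2 ≤ T + (Fintype.card V - 1) := by linarith
    have hr : ρ ^ 2 - ρ ≤ Fintype.card V - 1 := by
      by_contra! hcon
      nlinarith
    nlinarith

end Spectral

section Extremal

open Finset

/-- A graph in which every vertex of a two-element set is joined to every other vertex, and which
has no further edges, is `K_{2,n-2}`. -/
lemma nonempty_iso_completeBipartiteGraph {n : ℕ} {G : SimpleGraph (Fin n)} (P : Finset (Fin n))
    (hP : #P = 2) (hadj : ∀ v w, G.Adj v w ↔ (v ∈ P ∧ w ∉ P ∨ v ∉ P ∧ w ∈ P)) :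
    Nonempty (G ≃g completeBipartiteGraph (Fin 2) (Fin (n - 2))) := by
  have e₁ : {v // v ∈ P} ≃ Fin 2 := Fintype.equivFinOfCardEq (by simpa using hP)
  have e₂ : {v // v ∉ P} ≃ Fin (n - 2) := Fintype.equivFinOfCardEq (by
    rw [Fintype.card_subtype_compl, Fintype.card_fin, Fintype.card_coe, hP])
  let e : {v // v ∈ P} ⊕ {v // v ∉ P} ≃ Fin n := Equiv.sumCompl (· ∈ P)
  refine ⟨(⟨e.symm.trans (e₁.sumCongr e₂), fun {a b} => ?_⟩)⟩
  obtain ⟨a, rfl⟩ := e.surjective a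
  obtain ⟨b, rfl⟩ := e.surjective b
  rcases a with ⟨a, ha⟩ | ⟨a, ha⟩ <;> rcases b with ⟨b, hb⟩ | ⟨b, hb⟩ <;>
    simp [e, hadj, ha, hb]

/-- In the extremal case the neighbourhood of a maximal vertex is one side of a complete bipartite
graph. -/
lemma exists_adj_iff_of_sq_ge {V : Type*} [Fintype V] {G : SimpleGraph V}
    (hn : 6 ≤ Fintype.card V) (hG : ¬ HasChordedCycle G) {ρ : ℝ} (hρ0 : 0 ≤ ρ)
    (hρ : 2 * (Fintype.card V : ℝ) - 4 ≤ ρ ^ 2) {x : V → ℝ} (hx0 : ∀ v, 0 ≤ x v)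
    (hx1 : ∀ v, x v ≤ 1) (hx : ∀ v, ρ * x v ≤ ∑ w, adjInd G v w * x w) {u : V} (hu : x u = 1) :
    ∃ N M : Finset V, (∀ v, v ∈ N ↔ v ∉ M) ∧
      (#N = 2 ∨ #M = 2) ∧ ∀ v w, G.Adj v w ↔ (v ∈ N ∧ w ∉ N ∨ v ∉ N ∧ w ∈ N) := by
  classical
  let N : Finset V := {v | G.Adj u v}
  let M : Finset V := {v | ¬ G.Adj u v}
  have memN : ∀ {v}, v ∈ N ↔ G.Adj u v := by simp [N]
  have memM : ∀ {v}, v ∈ M ↔ ¬ G.Adj u v := by simp [M]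
  have huM : u ∈ M := memM.2 (G.loopless.irrefl u)
  have splitV : ∀ f : V → ℝ, ∑ w, f w = ∑ w ∈ N, f w + ∑ w ∈ M, f w := fun f =>
    (Finset.sum_filter_add_sum_filter_not univ _ f).symm
  have hcard : #N + #M = Fintype.card V := Finset.card_filter_add_card_filter_not _
  have hcardR : (#N : ℝ) + #M = Fintype.card V := by exact_mod_cast hcard
  have hdisj : Disjoint N M := Finset.disjoint_left.2 fun v hv hv' => memM.1 hv' (memN.1 hv)
  have tri : ∀ {m}, x m = 1 → ∀ {a b}, G.Adj m a → G.Adj m b → ¬ G.Adj a b := fun hm _ _ =>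
    not_adj_of_adj_of_adj hn hG hρ0 hρ hx0 hx1 hx hm
  have indN : ∀ v ∈ N, ∀ w ∈ N, ¬ G.Adj v w := fun v hv w hw =>
    tri hu (memN.1 hv) (memN.1 hw)
  have hle : ∀ v w, adjInd G v w * x w ≤ adjInd G v w := fun v w =>
    mul_le_of_le_one_right (adjInd_nonneg v w) (hx1 w)
  have hNN : ∀ v ∈ N, ∑ w ∈ N, adjInd G v w = 0 := fun v hv =>
    Finset.sum_eq_zero fun w hw => adjInd_of_not_adj (indN v hv w hw)
  have hub := sum_sum_adjInd_le_of_disjoint hG N M hdisj (by omega)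
  have hlb : ρ ^ 2 ≤ ∑ v ∈ N, ∑ w ∈ M, adjInd G v w * x w := by
    refine (sq_le_sum_sum hρ0 hx hu).trans (Finset.sum_le_sum fun v hv => ?_)
    rw [splitV, add_le_iff_nonpos_left, ← hNN v hv]
    exact Finset.sum_le_sum fun w _ => hle v w
  have hmid : ∑ v ∈ N, ∑ w ∈ M, adjInd G v w * x w ≤ ∑ v ∈ N, ∑ w ∈ M, adjInd G v w :=
    Finset.sum_le_sum fun v _ => Finset.sum_le_sum fun w _ => hle v w
  have hxM : ∀ w ∈ M, x w = 1 := by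
    intro w hw
    by_contra hw1
    have hlt : x w < 1 := lt_of_le_of_ne (hx1 w) hw1
    have hz : ∀ v ∈ N, adjInd G v w = 0 := by
      intro v hv
      have e1 := (Finset.sum_eq_sum_iff_of_le fun v _ => Finset.sum_le_sum fun w _ => hle v w).1
        (le_antisymm hmid (by linarith)) v hv
      have e2 := (Finset.sum_eq_sum_iff_of_le fun w _ => hle v w).1 e1 w hw
      have : adjInd G v w * (1 - x w) = 0 := by linarith
      rcases mul_eq_zero.1 this with h | h
      · exact h
      · linarith
    have h1 := sum_sum_adjInd_le_of_disjoint hG N (M.erase w)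
      (hdisj.mono_right (Finset.erase_subset _ _)) (by
        rw [Finset.card_erase_of_mem hw]; omega)
    have h2 : ∑ v ∈ N, ∑ w ∈ M, adjInd G v w = ∑ v ∈ N, ∑ w ∈ M.erase w, adjInd G v w :=
      Finset.sum_congr rfl fun v hv => by
        rw [← Finset.add_sum_erase M _ hw, hz v hv, zero_add]
    have h3 : (#(M.erase w) : ℝ) + 1 = #M := by
      exact_mod_cast Finset.card_erase_add_one hw
    linarith
  have htri : ∀ a b c, G.Adj a b → G.Adj b c → ¬ G.Adj a c := by
    intro a b c hab hbc hac
    by_cases ha : a ∈ N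
    · exact tri (hxM b (memM.2 fun hb => indN a ha b (memN.2 hb) hab)) hab.symm hbc hac
    · exact tri (hxM a (memM.2 fun h => ha (memN.2 h))) hab hac hbc
  have indM : ∀ v ∈ M, ∀ w ∈ M, ¬ G.Adj v w := by
    have hall := sum_sum_adjInd_le hG htri univ (by rw [Finset.card_univ]; omega)
    rw [Finset.card_univ] at hall
    simp only [splitV, Finset.sum_add_distrib] at hall
    have h1 : ∑ v ∈ M, ∑ w ∈ N, adjInd G v w = ∑ v ∈ N, ∑ w ∈ M, adjInd G v w := by
      rw [Finset.sum_comm]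
      exact Finset.sum_congr rfl fun v _ => Finset.sum_congr rfl fun w _ => adjInd_comm _ _
    have h2 : ∑ v ∈ N, ∑ w ∈ N, adjInd G v w = 0 := Finset.sum_eq_zero hNN
    intro v hv w hw hvw
    have h3 : adjInd G v w ≤ ∑ v ∈ M, ∑ w ∈ M, adjInd G v w :=
      (Finset.single_le_sum (f := fun w => adjInd G v w) (fun w _ => adjInd_nonneg v w) hw).trans
        (Finset.single_le_sum (f := fun v => ∑ w ∈ M, adjInd G v w)
          (fun v _ => Finset.sum_nonneg fun w _ => adjInd_nonneg v w) hv)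
    rw [adjInd_of_adj hvw] at h3
    linarith
  have hcomplete : ∀ m ∈ M, ∀ v ∈ N, G.Adj m v := by
    intro m hm v hv
    by_contra hmv
    have h1 : ρ ^ 2 ≤ ∑ v ∈ N.erase v, ∑ w ∈ M, adjInd G v w := by
      refine (sq_le_sum_sum hρ0 hx (hxM m hm)).trans ?_
      have hsub : ({z | G.Adj m z} : Finset V) ⊆ N.erase v := by
        intro z hz
        rw [Finset.mem_filter_univ] at hz
        refine Finset.mem_erase.2 ⟨fun h => hmv (h ▸ hz), ?_⟩
        by_contra hzN
        exact indM m hm z (memM.2 fun h => hzN (memN.2 h)) hz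
      refine (Finset.sum_le_sum_of_subset_of_nonneg hsub fun z _ _ =>
        Finset.sum_nonneg fun w _ => mul_nonneg (adjInd_nonneg z w) (hx0 w)).trans ?_
      refine Finset.sum_le_sum fun z hz => ?_
      have := hNN z (Finset.mem_of_mem_erase hz)
      calc _ ≤ ∑ w, adjInd G z w := Finset.sum_le_sum fun w _ => hle z w
        _ = _ := by rw [splitV, this, zero_add]
    have h2 : adjInd G v u ≤ ∑ w ∈ M, adjInd G v w :=
      Finset.single_le_sum (f := fun w => adjInd G v w) (fun w _ => adjInd_nonneg v w) huM
    rw [adjInd_of_adj (memN.1 hv).symm] at h2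
    rw [← Finset.add_sum_erase N _ hv] at hub
    linarith
  refine ⟨N, M, by simp [memN, memM], ?_, fun v w => ?_⟩
  · have hprod : ∑ v ∈ N, ∑ w ∈ M, adjInd G v w = (#N : ℝ) * #M := by
      calc _ = ∑ v ∈ N, ∑ w ∈ M, (1 : ℝ) := Finset.sum_congr rfl fun v hv =>
            Finset.sum_congr rfl fun w hw => adjInd_of_adj (hcomplete w hw v hv).symm
        _ = _ := by simp
    have : ((#N : ℝ) - 2) * (#M - 2) = 0 := by linarith
    rcases mul_eq_zero.1 this with h | h
    · left; exact_mod_cast sub_eq_zero.1 h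
    · right; exact_mod_cast sub_eq_zero.1 h
  · have hNM : ∀ {z}, z ∉ N → z ∈ M := fun hz => memM.2 fun h => hz (memN.2 h)
    by_cases hv : v ∈ N <;> by_cases hw : w ∈ N
    · simpa [hv, hw] using indN v hv w hw
    · simpa [hv, hw] using (hcomplete w (hNM hw) v hv).symm
    · simpa [hv, hw] using hcomplete v (hNM hv) w hw
    · simpa [hv, hw] using indM v (hNM hv) w (hNM hw)

end Extremal

theorem stmt_19 (n : ℕ) (hn : 6 ≤ n) (G : SimpleGraph (Fin n))
    (hρ : Real.sqrt (2 * n - 4) ≤ specRad G) :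
    HasChordedCycle G ∨
      Nonempty (G ≃g completeBipartiteGraph (Fin 2) (Fin (n - 2))) := by
  by_cases hG : HasChordedCycle G
  · exact .inl hG
  right
  have hnR : (6 : ℝ) ≤ n := by exact_mod_cast hn
  have hpos : 0 < specRad G := (Real.sqrt_pos.2 (by linarith)).trans_le hρ
  obtain ⟨x, hx0, hx1, ⟨u, hu⟩, hx⟩ := exists_le_sum_adjInd_mul hpos
  obtain ⟨N, M, hNM, hcard, hadj⟩ := exists_adj_iff_of_sq_ge (by simpa using hn) hG hpos.le
    (by simpa using (Real.sqrt_le_left hpos.le).1 hρ) hx0 hx1 hx hu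
  rcases hcard with h | h
  · exact nonempty_iso_completeBipartiteGraph N h hadj
  · refine nonempty_iso_completeBipartiteGraph M h fun v w => ?_
    rw [hadj, hNM, hNM]
    tauto
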